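/- arXiv:2008.00994 — 2 statements merged into one kernel-verified Lean document; each statement's English description precedes it below -/
import Mathlib

section
/- Let 0 < r₀ < R and α ∈ (2,4). Define the path loss P_L(r) = 1 for 0 ≤ r ≤ r₀ and P_L(r) = (r/r₀)^{−α} for r ≥ r₀. Then ∫₀^R √(P_L(r)) · (2r/R²) dr = −(α/(4−α)) (r₀/R)² + (4/(4−α)) (r₀/R)^{α/2}. -/
open Real

/-- `E[√(P_L(r))]` for a user uniformly distributed in a disk of radius `R`:
`∫₀^R √(P_L r) * (2 r / R²) dr = -(α/(4-α)) (r₀/R)² + (4/(4-α)) (r₀/R)^(α/2)`,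
where `P_L r = 1` for `r ≤ r₀` and `P_L r = (r/r₀)^(-α)` for `r ≥ r₀`. -/
theorem expectation_sqrt_path_loss
    (r₀ R α : ℝ) (hr₀ : 0 < r₀) (hR : r₀ < R) (hα : 2 < α ∧ α < 4)
    (PL : ℝ → ℝ)
    (hPL₁ : ∀ r, 0 ≤ r → r ≤ r₀ → PL r = 1)
    (hPL₂ : ∀ r, r₀ ≤ r → PL r = (r / r₀) ^ (-α)) :
    ∫ r in (0 : ℝ)..R, Real.sqrt (PL r) * (2 * r / R ^ 2) =
      -(α / (4 - α)) * (r₀ / R) ^ (2 : ℝ) + (4 / (4 - α)) * (r₀ / R) ^ (α / 2) := by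
  obtain ⟨-, hα4⟩ := hα
  have hR₀ : 0 < R := hr₀.trans hR
  have near : Set.EqOn (fun r => √(PL r) * (2 * r / R ^ 2)) (fun r => 2 / R ^ 2 * r)
      (Set.uIcc 0 r₀) := by
    intro r hr
    rw [Set.uIcc_of_le hr₀.le] at hr
    simp only [hPL₁ r hr.1 hr.2, sqrt_one]
    ring
  have far : Set.EqOn (fun r => √(PL r) * (2 * r / R ^ 2))
      (fun r => 2 * r₀ ^ (α / 2) / R ^ 2 * r ^ (1 - α / 2)) (Set.uIcc r₀ R) := by
    intro r hr
    rw [Set.uIcc_of_le hR.le] at hr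
    have hr_pos : 0 < r := hr₀.trans_le hr.1
    have hsqrt : √((r / r₀) ^ (-α)) = r₀ ^ (α / 2) / r ^ (α / 2) := by
      rw [sqrt_eq_rpow, ← rpow_mul (div_pos hr_pos hr₀).le,
        show -α * (1 / 2) = -(α / 2) by ring, rpow_neg (div_pos hr_pos hr₀).le,
        div_rpow hr_pos.le hr₀.le, inv_div]
    simp only [hPL₂ r hr.1, hsqrt, rpow_sub hr_pos, rpow_one]
    ring
  have hzero : (0 : ℝ) ∉ Set.uIcc r₀ R := Set.notMem_uIcc_of_lt hr₀ hR₀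
  have near_int : IntervalIntegrable (fun r => √(PL r) * (2 * r / R ^ 2))
      MeasureTheory.volume 0 r₀ :=
    (Continuous.intervalIntegrable (by fun_prop) _ _ :
      IntervalIntegrable (fun r : ℝ => 2 / R ^ 2 * r) MeasureTheory.volume 0 r₀).congr
      fun r hr => (near (Set.uIoc_subset_uIcc hr)).symm
  have far_int : IntervalIntegrable (fun r => √(PL r) * (2 * r / R ^ 2))
      MeasureTheory.volume r₀ R :=
    ((intervalIntegral.intervalIntegrable_rpow (Or.inr hzero)).const_mul _).congr
      fun r hr => (far (Set.uIoc_subset_uIcc hr)).symm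
  rw [← intervalIntegral.integral_add_adjacent_intervals near_int far_int,
    intervalIntegral.integral_congr near, intervalIntegral.integral_congr far,
    intervalIntegral.integral_const_mul, intervalIntegral.integral_const_mul, integral_id,
    integral_rpow (Or.inl (by linarith)), show 1 - α / 2 + 1 = 2 - α / 2 by ring,
    rpow_sub hR₀, rpow_sub hr₀, div_rpow hr₀.le hR₀.le, div_rpow hr₀.le hR₀.le, rpow_two, rpow_two]
  have h4 : 4 - α ≠ 0 := by linarith
  rw [show 2 - α / 2 = (4 - α) / 2 by ring]
  have hA : r₀ ^ (α / 2) ≠ 0 := (rpow_pos_of_pos hr₀ _).ne'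
  have hB : R ^ (α / 2) ≠ 0 := (rpow_pos_of_pos hR₀ _).ne'
  generalize r₀ ^ (α / 2) = A at *
  generalize R ^ (α / 2) = B at *
  field_simp
  ring
end

section
/- Let a > 0, b > 0, let S be a nonempty finite set of nonnegative real numbers, and define g(ρ) = (ρ + a)²/(ρ² + b) and φ(ρ) = |1/(ρ + a) − a/(a² + b)| for ρ ≥ 0. Then for any ρ* ∈ S, ρ* minimizes φ over S if and only if ρ* maximizes g over S. -/
/-- The reciprocal of the objective is an increasing affine function of the squared deviation
of `1 / (ρ + a)` from `a / (a ^ 2 + b)`. -/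
lemma inv_objective_eq_deviation_sq {a b ρ : ℝ} (hρ : ρ + a ≠ 0) (hab : a ^ 2 + b ≠ 0) :
    ((ρ + a) ^ 2 / (ρ ^ 2 + b))⁻¹ =
      (a ^ 2 + b) * (1 / (ρ + a) - a / (a ^ 2 + b)) ^ 2 + b / (a ^ 2 + b) := by
  rw [inv_div]
  field_simp
  ring

lemma deviation_le_iff_objective_le {a b x y : ℝ} (ha : 0 < a) (hb : 0 < b)
    (hx : 0 ≤ x) (hy : 0 ≤ y) :
    |1 / (x + a) - a / (a ^ 2 + b)| ≤ |1 / (y + a) - a / (a ^ 2 + b)| ↔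
      (y + a) ^ 2 / (y ^ 2 + b) ≤ (x + a) ^ 2 / (x ^ 2 + b) := by
  have hab : 0 < a ^ 2 + b := by positivity
  have hgx : 0 < (x + a) ^ 2 / (x ^ 2 + b) := by positivity
  have hgy : 0 < (y + a) ^ 2 / (y ^ 2 + b) := by positivity
  rw [← inv_le_inv₀ hgx hgy, inv_objective_eq_deviation_sq (by positivity) hab.ne',
    inv_objective_eq_deviation_sq (by positivity) hab.ne', add_le_add_iff_right,
    mul_le_mul_iff_right₀ hab, sq_le_sq]

/-- **Correctness of the one-variable greedy update.** For `a > 0`, `b > 0`, a nonempty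
finite set `S` of nonnegative reals, `g ρ = (ρ + a)²/(ρ² + b)` and
`φ ρ = |1/(ρ + a) - a/(a² + b)|`, an element `ρ* ∈ S` minimizes `φ` over `S`
iff it maximizes `g` over `S`. -/
theorem relay_selection_min_phi_iff_max_g
    (a b : ℝ) (ha : 0 < a) (hb : 0 < b)
    (S : Finset ℝ) (hS : S.Nonempty) (hS_nonneg : ∀ ρ ∈ S, 0 ≤ ρ)
    (g φ : ℝ → ℝ)
    (hg : ∀ ρ, 0 ≤ ρ → g ρ = (ρ + a) ^ 2 / (ρ ^ 2 + b))
    (hφ : ∀ ρ, 0 ≤ ρ → φ ρ = |1 / (ρ + a) - a / (a ^ 2 + b)|) :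
    ∀ ρs ∈ S, ((∀ ρ ∈ S, φ ρs ≤ φ ρ) ↔ (∀ ρ ∈ S, g ρ ≤ g ρs)) := by
  intro ρs hρs
  refine forall₂_congr fun ρ hρ => ?_
  have hs := hS_nonneg ρs hρs
  have h := hS_nonneg ρ hρ
  rw [hφ ρs hs, hφ ρ h, hg ρs hs, hg ρ h]
  exact deviation_le_iff_objective_le ha hb hs h
end
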